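/- Let V be a ⋆-unitary (1+n+1)×(1+n+1) Belavkin matrix over 𝔅 with the middle indices partitioned into external indices e (size n_e) and internal indices i (size n_i), 0 < n_i < n, and let X be a unitary n_i×n_i complex matrix such that 1 - V_{ii}X is invertible. Then the ⋆-involution of the reduced matrix satisfies 𝓕(V, X)⋆ = 𝓕(V⋆, X†), where on the left ⋆ is the involution on (1+n_e+1)×(1+n_e+1) Belavkin matrices (with respect to J_{n_e}), and on the right V⋆ = J_n V† J_n is the involution on (1+n+1)×(1+n+1) Belavkin matrices and X† is the conjugate transpose of X. -/

import Mathlib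

noncomputable section

open scoped BigOperators Matrix

/-- The Belavkin index set `{0} ⊕ middle ⊕ {0′}`. -/
abbrev BIdx (ι : Type*) : Type _ := Unit ⊕ ι ⊕ Unit

/-- The Belavkin `J` matrix: identity of the ring in positions `(0,0′)` and `(0′,0)`,
the identity in the middle block, and `0` elsewhere. -/
def Jmat (R : Type*) [Zero R] [One R] (ι : Type*) [DecidableEq ι] :
    Matrix (BIdx ι) (BIdx ι) R :=
  Matrix.of fun p q =>
    match p, q with
    | Sum.inl _, Sum.inr (Sum.inr _) => (1 : R)
    | Sum.inr (Sum.inr _), Sum.inl _ => 1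
    | Sum.inr (Sum.inl j), Sum.inr (Sum.inl k) => if j = k then 1 else 0
    | _, _ => 0

/-- The `⋆`-involution of a Belavkin matrix: `𝕏⋆ := J 𝕏† J`. -/
def bstar {R : Type*} [Semiring R] [StarRing R] {ι : Type*} [Fintype ι] [DecidableEq ι]
    (X : Matrix (BIdx ι) (BIdx ι) R) : Matrix (BIdx ι) (BIdx ι) R :=
  Jmat R ι * Xᴴ * Jmat R ι

/-- Embedding of the reduced (external) Belavkin index set into the full one,
relative to the partition `{1,…,n} = e ⊔ i`. -/
def embE {ne ni : ℕ} : BIdx (Fin ne) → BIdx (Fin ne ⊕ Fin ni)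
  | Sum.inl u => Sum.inl u
  | Sum.inr (Sum.inl e) => Sum.inr (Sum.inl (Sum.inl e))
  | Sum.inr (Sum.inr u) => Sum.inr (Sum.inr u)

/-- Embedding of an internal index into the full Belavkin index set. -/
def intI {ne ni : ℕ} (j : Fin ni) : BIdx (Fin ne ⊕ Fin ni) :=
  Sum.inr (Sum.inl (Sum.inr j))

/-- The internal-internal sub-block `V_ii`. -/
def blkII {R : Type*} {ne ni : ℕ}
    (V : Matrix (BIdx (Fin ne ⊕ Fin ni)) (BIdx (Fin ne ⊕ Fin ni)) R) :
    Matrix (Fin ni) (Fin ni) R :=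
  Matrix.of fun j k => V (intI j) (intI k)

/-- The block column `V_{αi}`, `α ∈ {0} ∪ e ∪ {0′}` (i.e. `(V_0i; V_ei; V_0′i)`). -/
def blkEI {R : Type*} {ne ni : ℕ}
    (V : Matrix (BIdx (Fin ne ⊕ Fin ni)) (BIdx (Fin ne ⊕ Fin ni)) R) :
    Matrix (BIdx (Fin ne)) (Fin ni) R :=
  Matrix.of fun a j => V (embE a) (intI j)

/-- The block row `V_{iβ}`, `β ∈ {0} ∪ e ∪ {0′}` (i.e. `(V_i0, V_ie, V_i0′)`). -/
def blkIE {R : Type*} {ne ni : ℕ}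
    (V : Matrix (BIdx (Fin ne ⊕ Fin ni)) (BIdx (Fin ne ⊕ Fin ni)) R) :
    Matrix (Fin ni) (BIdx (Fin ne)) R :=
  Matrix.of fun j b => V (intI j) (embE b)

/-- The external sub-matrix `V_{αβ}`, `α, β ∈ {0} ∪ e ∪ {0′}`. -/
def blkEE {R : Type*} {ne ni : ℕ}
    (V : Matrix (BIdx (Fin ne ⊕ Fin ni)) (BIdx (Fin ne ⊕ Fin ni)) R) :
    Matrix (BIdx (Fin ne)) (BIdx (Fin ne)) R :=
  Matrix.of fun a b => V (embE a) (embE b)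

variable {H₀ : Type*} [NormedAddCommGroup H₀] [InnerProductSpace ℂ H₀] [CompleteSpace H₀]

/-- The Gough–James feedback reduction
`𝓕(V, X)_{αβ} = V_{αβ} + V_{αi} X (1 - V_{ii}X)⁻¹ V_{iβ}` of a Belavkin matrix `V`
by a complex `n_i × n_i` matrix `X` (regarded in `𝔅` via `algebraMap`). -/
def FRed {ne ni : ℕ}
    (V : Matrix (BIdx (Fin ne ⊕ Fin ni)) (BIdx (Fin ne ⊕ Fin ni)) (H₀ →L[ℂ] H₀))
    (X : Matrix (Fin ni) (Fin ni) ℂ) :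
    Matrix (BIdx (Fin ne)) (BIdx (Fin ne)) (H₀ →L[ℂ] H₀) :=
  blkEE V + blkEI V * X.map (algebraMap ℂ (H₀ →L[ℂ] H₀)) *
    Ring.inverse (1 - blkII V * X.map (algebraMap ℂ (H₀ →L[ℂ] H₀))) * blkIE V

/-- The involution of the Belavkin index set exchanging `0` and `0′`. -/
def swapEnds {ι : Type*} : BIdx ι → BIdx ι
  | Sum.inl u => Sum.inr (Sum.inr u)
  | Sum.inr (Sum.inl j) => Sum.inr (Sum.inl j)
  | Sum.inr (Sum.inr u) => Sum.inl u

theorem Jmat_mul {R : Type*} [Semiring R] {ι κ : Type*} [Fintype ι] [DecidableEq ι]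
    (M : Matrix (BIdx ι) κ R) : Jmat R ι * M = M.submatrix swapEnds id := by
  ext p q
  rcases p with _ | j | _ <;> simp [Matrix.mul_apply, Jmat, swapEnds]

theorem mul_Jmat {R : Type*} [Semiring R] {ι κ : Type*} [Fintype ι] [DecidableEq ι]
    (M : Matrix κ (BIdx ι) R) : M * Jmat R ι = M.submatrix id swapEnds := by
  ext p q
  rcases q with _ | j | _ <;> simp [Matrix.mul_apply, Jmat, swapEnds]

theorem bstar_eq_submatrix {R : Type*} [Semiring R] [StarRing R] {ι : Type*} [Fintype ι]
    [DecidableEq ι] (X : Matrix (BIdx ι) (BIdx ι) R) :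
    bstar X = Xᴴ.submatrix swapEnds swapEnds := by
  rw [bstar, Jmat_mul, mul_Jmat, Matrix.submatrix_submatrix]
  rfl

theorem swapEnds_embE {ne ni : ℕ} (a : BIdx (Fin ne)) :
    swapEnds (embE a : BIdx (Fin ne ⊕ Fin ni)) = embE (swapEnds a) := by
  rcases a with _ | _ | _ <;> rfl

theorem swapEnds_intI {ne ni : ℕ} (j : Fin ni) :
    swapEnds (intI j : BIdx (Fin ne ⊕ Fin ni)) = intI j :=
  rfl

section Blocks

variable {R : Type*} [Semiring R] [StarRing R] {ne ni : ℕ}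
  (V : Matrix (BIdx (Fin ne ⊕ Fin ni)) (BIdx (Fin ne ⊕ Fin ni)) R)

theorem blkII_bstar : blkII (bstar V) = (blkII V)ᴴ := by
  ext j k
  simp [blkII, bstar_eq_submatrix, swapEnds_intI]

theorem blkEI_bstar : blkEI (bstar V) = Jmat R (Fin ne) * (blkIE V)ᴴ := by
  ext a j
  simp [blkEI, blkIE, bstar_eq_submatrix, Jmat_mul, swapEnds_intI, swapEnds_embE]

theorem blkIE_bstar : blkIE (bstar V) = (blkEI V)ᴴ * Jmat R (Fin ne) := by
  ext j b
  simp [blkEI, blkIE, bstar_eq_submatrix, mul_Jmat, swapEnds_intI, swapEnds_embE]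

theorem blkEE_bstar : blkEE (bstar V) = bstar (blkEE V) := by
  ext a b
  simp [blkEE, bstar_eq_submatrix, swapEnds_embE]

end Blocks

/-- The push-through identity for an invertible left factor. -/
theorem inverse_one_sub_mul_comm {R : Type*} [Ring R] {a b : R} (ha : IsUnit a)
    (h : IsUnit (1 - a * b)) :
    Ring.inverse (1 - a * b) * a = a * Ring.inverse (1 - b * a) := by
  have hab : (1 - a * b) * a = a * (1 - b * a) := by noncomm_ring
  have h' : IsUnit (1 - b * a) := ha.mul_left_iff.mp (by rw [← hab]; exact h.mul ha)
  rw [← Ring.inverse_mul_cancel_left _ (a * Ring.inverse (1 - b * a)) h, ← mul_assoc (1 - a * b),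
    hab, Ring.mul_inverse_cancel_right _ _ h']

theorem conjTranspose_map_algebraMap {A m n : Type*} [Ring A] [StarRing A] [Algebra ℂ A]
    [StarModule ℂ A] (X : Matrix m n ℂ) :
    (X.map (algebraMap ℂ A))ᴴ = Xᴴ.map (algebraMap ℂ A) :=
  (Matrix.conjTranspose_map _ algebraMap_star_comm).symm

/-- For `V` `⋆`-unitary and `X` unitary with `1 - V_ii X`
invertible, the `⋆`-involution of the feedback reduction satisfies
`𝓕(V, X)⋆ = 𝓕(V⋆, X†)` (the left `⋆` being on `(1+n_e+1)`-indexed Belavkin matrices,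
the right one on `(1+n+1)`-indexed ones). -/
theorem bstar_FRed (ne ni : ℕ) (hne : 0 < ne) (hni : 0 < ni)
    (V : Matrix (BIdx (Fin ne ⊕ Fin ni)) (BIdx (Fin ne ⊕ Fin ni)) (H₀ →L[ℂ] H₀))
    (hV₁ : V * bstar V = 1) (hV₂ : bstar V * V = 1)
    (X : Matrix (Fin ni) (Fin ni) ℂ)
    (hX₁ : X * Xᴴ = 1) (hX₂ : Xᴴ * X = 1)
    (hinv : IsUnit (1 - blkII V * X.map (algebraMap ℂ (H₀ →L[ℂ] H₀)))) :
    bstar (FRed V X) = FRed (bstar V) Xᴴ := by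
  have hXu : IsUnit (Xᴴ.map (algebraMap ℂ (H₀ →L[ℂ] H₀))) :=
    (IsUnit.of_mul_eq_one X hX₂).map (algebraMap ℂ (H₀ →L[ℂ] H₀)).mapMatrix
  have hconj : (1 - blkII V * X.map (algebraMap ℂ (H₀ →L[ℂ] H₀)))ᴴ =
      1 - Xᴴ.map (algebraMap ℂ (H₀ →L[ℂ] H₀)) * (blkII V)ᴴ := by
    rw [Matrix.conjTranspose_sub, Matrix.conjTranspose_one, Matrix.conjTranspose_mul,
      conjTranspose_map_algebraMap]
  have hpush := inverse_one_sub_mul_comm hXu (by rw [← hconj]; exact hinv.star)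
  have hinvstar : (Ring.inverse (1 - blkII V * X.map (algebraMap ℂ (H₀ →L[ℂ] H₀))))ᴴ =
      Ring.inverse (1 - Xᴴ.map (algebraMap ℂ (H₀ →L[ℂ] H₀)) * (blkII V)ᴴ) := by
    rw [← hconj]
    exact (Ring.inverse_star _).symm
  rw [FRed, FRed, blkEE_bstar, blkEI_bstar, blkIE_bstar, blkII_bstar, bstar, bstar,
    Matrix.conjTranspose_add, Matrix.mul_add, Matrix.add_mul]
  simp only [Matrix.conjTranspose_mul, hinvstar, conjTranspose_map_algebraMap]
  rw [Matrix.mul_assoc (Jmat _ _ * _) (Xᴴ.map _), ← hpush]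
  simp only [Matrix.mul_assoc]
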